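/- arXiv:2510.18376 — 2 statements merged into one kernel-verified Lean document; each statement's English description precedes it below -/
import Mathlib

section
/- There exist constants C>0 and ε₀∈(0,1) such that for all ν∈(0,1], all k∈ℝ with 10ν≤|k|<1, all λ∈ℝ, all ε∈[0,ε₀], every continuous F:I→ℂ, and every solution w of the Navier-slip Orr–Sommerfeld problem with data F, one has ν^{1/6}|k|^{5/6}‖u‖_{L²}+ν^{1/6}|k|^{5/6}‖w‖_{L¹(I)}+ν^{2/3}|k|^{1/3}‖w′‖_{L²(I)}+(ν|k|²)^{1/3}‖w‖_{L²(I)}+|k|‖(y−λ)w‖_{L²(I)} ≤ C‖F‖_{L²(I)}, where ‖(y−λ)w‖_{L²(I)} is the L² norm of y↦(y−λ)w(y). -/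
open MeasureTheory Set

noncomputable section

/-- `L²` norm on `I = [-1,1]`. -/
def L2I (f : ℝ → ℂ) : ℝ := Real.sqrt (∫ y in (-1:ℝ)..1, ‖f y‖ ^ 2)

/-- `L¹` norm on `I = [-1,1]`. -/
def L1I (f : ℝ → ℂ) : ℝ := ∫ y in (-1:ℝ)..1, ‖f y‖

/-- The Navier-slip Orr–Sommerfeld problem on `I = [-1,1]` with data `F`:
`−ν(w″−k²w)+ik(y−λ)w−εν^{1/3}|k|^{2/3}w = F` on `I`, `w(±1)=0`. -/
def NavierSlipOS (ν k lam ε : ℝ) (w F : ℝ → ℂ) : Prop :=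
  ContDiff ℝ 2 w ∧ w (-1) = 0 ∧ w 1 = 0 ∧
  ∀ y ∈ Icc (-1:ℝ) 1,
    -(ν : ℂ) * (deriv (deriv w) y - (k : ℂ) ^ 2 * w y)
      + Complex.I * (k : ℂ) * ((y : ℂ) - (lam : ℂ)) * w y
      - ((ε * ν ^ ((1:ℝ)/3) * |k| ^ ((2:ℝ)/3) : ℝ) : ℂ) * w y = F y

/-- `φ` solves `φ″ − k²φ = w` on `I` with `φ(±1)=0`. -/
def IsStream (k : ℝ) (w φ : ℝ → ℂ) : Prop :=
  ContDiff ℝ 2 φ ∧ φ (-1) = 0 ∧ φ 1 = 0 ∧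
  ∀ y ∈ Icc (-1:ℝ) 1, deriv (deriv φ) y - (k : ℂ) ^ 2 * φ y = w y

/-- `‖u‖_{L²}² = ‖φ′‖² + k²‖φ‖²`. -/
def uNorm (k : ℝ) (φ : ℝ → ℂ) : ℝ :=
  Real.sqrt (L2I (deriv φ) ^ 2 + k ^ 2 * L2I φ ^ 2)

/-- The square of the `L²` norm is the integral of the squared modulus. -/
lemma L2I_sq (f : ℝ → ℂ) : L2I f ^ 2 = ∫ y in (-1:ℝ)..1, ‖f y‖ ^ 2 :=
  Real.sq_sqrt (intervalIntegral.integral_nonneg (by norm_num) fun _ _ => by positivity)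

lemma L2I_nonneg (f : ℝ → ℂ) : 0 ≤ L2I f := Real.sqrt_nonneg _

lemma L2I_congr {f g : ℝ → ℂ} (h : ∀ y ∈ Icc (-1:ℝ) 1, f y = g y) : L2I f = L2I g := by
  unfold L2I
  congr 1
  refine intervalIntegral.integral_congr fun y hy => ?_
  rw [uIcc_of_le (by norm_num)] at hy
  simp only [h y hy]

/-- Cauchy–Schwarz inequality on `[-1,1]`. -/
lemma integral_norm_mul_norm_le {f g : ℝ → ℂ} (hf : Continuous f) (hg : Continuous g) :
    ∫ y in (-1:ℝ)..1, ‖f y‖ * ‖g y‖ ≤ L2I f * L2I g := by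
  set P := ∫ y in (-1:ℝ)..1, ‖f y‖ * ‖g y‖ with hP
  have key : ∀ t : ℝ, 0 ≤ L2I g ^ 2 * (t * t) + (2 * P) * t + L2I f ^ 2 := by
    intro t
    have e : ∫ y in (-1:ℝ)..1, (‖f y‖ + t * ‖g y‖) ^ 2
        = L2I g ^ 2 * (t * t) + (2 * P) * t + L2I f ^ 2 := by
      rw [L2I_sq, L2I_sq, hP, ← intervalIntegral.integral_mul_const,
        ← intervalIntegral.integral_const_mul, ← intervalIntegral.integral_mul_const,
        ← intervalIntegral.integral_add, ← intervalIntegral.integral_add]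
      · exact intervalIntegral.integral_congr fun y _ => by ring
      all_goals exact Continuous.intervalIntegrable (by fun_prop) _ _
    rw [← e]
    exact intervalIntegral.integral_nonneg (by norm_num) fun _ _ => by positivity
  have hd := discrim_le_zero key
  unfold discrim at hd
  refine abs_le_of_sq_le_sq' ?_ (mul_nonneg (L2I_nonneg f) (L2I_nonneg g)) |>.2
  nlinarith

lemma integral_le_L2I_mul_L2I {f g : ℝ → ℂ} {h : ℝ → ℝ} (hf : Continuous f) (hg : Continuous g)
    (hh : Continuous h) (hle : ∀ y, h y ≤ ‖f y‖ * ‖g y‖) :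
    ∫ y in (-1:ℝ)..1, h y ≤ L2I f * L2I g :=
  (intervalIntegral.integral_mono_on (by norm_num) (hh.intervalIntegrable _ _)
    (Continuous.intervalIntegrable (by fun_prop) _ _) fun y _ => hle y).trans
    (integral_norm_mul_norm_le hf hg)

lemma re_mul_conj_le (z v : ℂ) : z.re * v.re + z.im * v.im ≤ ‖z‖ * ‖v‖ := by
  have := (Complex.re_le_norm (z * (starRingEnd ℂ) v))
  simpa using this

lemma im_mul_conj_le (z v : ℂ) : z.im * v.re - z.re * v.im ≤ ‖z‖ * ‖v‖ := by
  have := (Complex.im_le_norm (z * (starRingEnd ℂ) v))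
  simp at this
  linarith

lemma im_mul_conj_ge (z v : ℂ) : z.re * v.im - z.im * v.re ≤ ‖z‖ * ‖v‖ := by
  have := im_mul_conj_le v z
  linarith [mul_comm ‖z‖ ‖v‖]

lemma norm_sq_eq_re_im (z : ℂ) : ‖z‖ ^ 2 = z.re ^ 2 + z.im ^ 2 := by
  rw [Complex.sq_norm, Complex.normSq_apply]; ring

lemma hasDerivAt_re {w : ℝ → ℂ} {w' : ℂ} {y : ℝ} (h : HasDerivAt w w' y) :
    HasDerivAt (fun x => (w x).re) w'.re y :=
  (Complex.reCLM.hasFDerivAt.comp_hasDerivAt y h)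

lemma hasDerivAt_im {w : ℝ → ℂ} {w' : ℂ} {y : ℝ} (h : HasDerivAt w w' y) :
    HasDerivAt (fun x => (w x).im) w'.im y :=
  (Complex.imCLM.hasFDerivAt.comp_hasDerivAt y h)

/-- First and second derivatives of a `C²` function, with their continuity. -/
lemma contDiff_two_data {w : ℝ → ℂ} (hw : ContDiff ℝ 2 w) :
    (∀ y, HasDerivAt w (deriv w y) y) ∧ (∀ y, HasDerivAt (deriv w) (deriv (deriv w) y) y) ∧
      Continuous w ∧ Continuous (deriv w) ∧ Continuous (deriv (deriv w)) := by
  have h1 : ContDiff ℝ 1 (deriv w) :=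
    (contDiff_succ_iff_deriv (n := 1) (f := w)).1 (by simpa [one_add_one_eq_two] using hw) |>.2.2
  refine ⟨fun y => (hw.differentiable (by norm_num) y).hasDerivAt,
    fun y => (h1.differentiable (by norm_num) y).hasDerivAt, hw.continuous, h1.continuous, ?_⟩
  exact h1.continuous_deriv le_rfl

/-- Integrating a derivative of a function vanishing at both endpoints. -/
lemma integral_eq_zero_of_hasDerivAt {g g' : ℝ → ℝ} (h : ∀ y, HasDerivAt g (g' y) y)
    (hc : Continuous g') (h0 : g (-1) = 0) (h1 : g 1 = 0) : ∫ y in (-1:ℝ)..1, g' y = 0 := by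
  rw [intervalIntegral.integral_eq_sub_of_hasDerivAt (fun y _ => h y) (hc.intervalIntegrable _ _),
    h0, h1, sub_zero]

/-- Uncertainty-type inequality `‖w‖² ≤ 2 ‖(y-λ)w‖ ‖w'‖`. -/
lemma L2I_sq_le_weight_mul_deriv {w : ℝ → ℂ} (hw : ContDiff ℝ 2 w) (h0 : w (-1) = 0)
    (h1 : w 1 = 0) (lam : ℝ) :
    L2I w ^ 2 ≤ 2 * (L2I (fun y => ((y : ℂ) - (lam : ℂ)) * w y) * L2I (deriv w)) := by
  obtain ⟨d1, -, c0, c1, -⟩ := contDiff_two_data hw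
  have hz := integral_eq_zero_of_hasDerivAt
    (g := fun y => (y - lam) * ((w y).re ^ 2 + (w y).im ^ 2))
    (g' := fun y => ((w y).re ^ 2 + (w y).im ^ 2)
      + (y - lam) * (2 * ((w y).re * (deriv w y).re + (w y).im * (deriv w y).im)))
    (fun y => by
      have := ((hasDerivAt_id y).sub_const lam).mul
        (((hasDerivAt_re (d1 y)).pow 2).add ((hasDerivAt_im (d1 y)).pow 2))
      exact this.congr_deriv (by simp [-mul_eq_mul_left_iff]; ring))
    (by fun_prop) (by simp [h0]) (by simp [h1])
  have hcs := integral_le_L2I_mul_L2I (f := fun y => ((y : ℂ) - (lam : ℂ)) * w y)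
    (g := deriv w)
    (h := fun y => - ((y - lam) * ((w y).re * (deriv w y).re + (w y).im * (deriv w y).im)))
    (by fun_prop) c1 (by fun_prop) (fun y => by
      have := re_mul_conj_le (-(((y : ℂ) - (lam : ℂ)) * w y)) (deriv w y)
      rw [norm_neg] at this
      refine le_trans (le_of_eq ?_) this
      simp
      ring)
  rw [L2I_sq]
  have e : ∫ y in (-1:ℝ)..1, ‖w y‖ ^ 2 = (∫ y in (-1:ℝ)..1, (((w y).re ^ 2 + (w y).im ^ 2)
      + (y - lam) * (2 * ((w y).re * (deriv w y).re + (w y).im * (deriv w y).im))))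
      + 2 * ∫ y in (-1:ℝ)..1,
        - ((y - lam) * ((w y).re * (deriv w y).re + (w y).im * (deriv w y).im)) := by
    rw [← intervalIntegral.integral_const_mul, ← intervalIntegral.integral_add]
    · exact intervalIntegral.integral_congr fun y _ => by
        simp only [norm_sq_eq_re_im]; ring
    all_goals exact Continuous.intervalIntegrable (by fun_prop) _ _
  rw [e, hz]
  linarith

/-- Energy estimate obtained by testing the equation against `w`. -/
lemma energy_estimate {ν k lam E : ℝ} (hν : 0 ≤ ν) {w G : ℝ → ℂ} (hw : ContDiff ℝ 2 w)
    (h0 : w (-1) = 0) (h1 : w 1 = 0)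
    (hG : ∀ y, -(ν : ℂ) * (deriv (deriv w) y - (k : ℂ) ^ 2 * w y)
      + Complex.I * (k : ℂ) * ((y : ℂ) - (lam : ℂ)) * w y - (E : ℂ) * w y = G y) :
    ν * L2I (deriv w) ^ 2 ≤ E * L2I w ^ 2 + L2I G * L2I w := by
  obtain ⟨d1, d2, c0, c1, c2⟩ := contDiff_two_data hw
  have cG : Continuous G := by
    rw [← funext hG]; fun_prop
  have hz := integral_eq_zero_of_hasDerivAt
    (g := fun y => (deriv w y).re * (w y).re + (deriv w y).im * (w y).im)
    (g' := fun y => (deriv (deriv w) y).re * (w y).re + (deriv w y).re * (deriv w y).re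
      + ((deriv (deriv w) y).im * (w y).im + (deriv w y).im * (deriv w y).im))
    (fun y => ((hasDerivAt_re (d2 y)).mul (hasDerivAt_re (d1 y))).add
      ((hasDerivAt_im (d2 y)).mul (hasDerivAt_im (d1 y))))
    (by fun_prop) (by simp [h0]) (by simp [h1])
  have hcs := integral_le_L2I_mul_L2I (h := fun y => (G y).re * (w y).re + (G y).im * (w y).im)
    cG c0 (by fun_prop) (fun y => re_mul_conj_le _ _)
  have e : ∫ y in (-1:ℝ)..1, ((G y).re * (w y).re + (G y).im * (w y).im)
      = ν * L2I (deriv w) ^ 2 + (ν * k ^ 2 - E) * L2I w ^ 2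
        - ν * ∫ y in (-1:ℝ)..1, ((deriv (deriv w) y).re * (w y).re
          + (deriv w y).re * (deriv w y).re
          + ((deriv (deriv w) y).im * (w y).im + (deriv w y).im * (deriv w y).im)) := by
    rw [L2I_sq, L2I_sq, ← intervalIntegral.integral_const_mul,
      ← intervalIntegral.integral_const_mul, ← intervalIntegral.integral_const_mul,
      ← intervalIntegral.integral_add, ← intervalIntegral.integral_sub]
    · refine intervalIntegral.integral_congr fun y _ => ?_
      simp only [norm_sq_eq_re_im, ← hG y]
      simp [pow_two]
      ring
    all_goals exact Continuous.intervalIntegrable (by fun_prop) _ _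
  rw [hz] at e
  have : 0 ≤ ν * k ^ 2 * L2I w ^ 2 := by positivity
  linarith

/-- Weighted estimate obtained by testing the equation against `(y-λ)w`. -/
lemma weighted_estimate {ν k lam E : ℝ} (hν : 0 ≤ ν) {w G : ℝ → ℂ} (hw : ContDiff ℝ 2 w)
    (h0 : w (-1) = 0) (h1 : w 1 = 0)
    (hG : ∀ y, -(ν : ℂ) * (deriv (deriv w) y - (k : ℂ) ^ 2 * w y)
      + Complex.I * (k : ℂ) * ((y : ℂ) - (lam : ℂ)) * w y - (E : ℂ) * w y = G y) :
    |k| * L2I (fun y => ((y : ℂ) - (lam : ℂ)) * w y) ^ 2 ≤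
      L2I G * L2I (fun y => ((y : ℂ) - (lam : ℂ)) * w y) + ν * (L2I (deriv w) * L2I w) := by
  obtain ⟨d1, d2, c0, c1, c2⟩ := contDiff_two_data hw
  have cG : Continuous G := by
    rw [← funext hG]; fun_prop
  have hz := integral_eq_zero_of_hasDerivAt
    (g := fun y => (y - lam) * ((deriv w y).im * (w y).re - (deriv w y).re * (w y).im))
    (g' := fun y => ((deriv w y).im * (w y).re - (deriv w y).re * (w y).im)
      + (y - lam) * ((deriv (deriv w) y).im * (w y).re - (deriv (deriv w) y).re * (w y).im))
    (fun y => by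
      have := ((hasDerivAt_id y).sub_const lam).mul
        (((hasDerivAt_im (d2 y)).mul (hasDerivAt_re (d1 y))).sub
          ((hasDerivAt_re (d2 y)).mul (hasDerivAt_im (d1 y))))
      exact this.congr_deriv (by simp [-mul_eq_mul_left_iff]; ring))
    (by fun_prop) (by simp [h0]) (by simp [h1])
  set W : ℝ → ℂ := fun y => ((y : ℂ) - (lam : ℂ)) * w y with hW
  have cW : Continuous W := by rw [hW]; fun_prop
  have e : ∫ y in (-1:ℝ)..1, ((G y).im * (W y).re - (G y).re * (W y).im)
      = k * L2I W ^ 2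
        - ν * (∫ y in (-1:ℝ)..1, (((deriv w y).im * (w y).re - (deriv w y).re * (w y).im)
          + (y - lam) * ((deriv (deriv w) y).im * (w y).re
            - (deriv (deriv w) y).re * (w y).im)))
        + ν * ∫ y in (-1:ℝ)..1, ((deriv w y).im * (w y).re - (deriv w y).re * (w y).im) := by
    rw [L2I_sq, ← intervalIntegral.integral_const_mul,
      ← intervalIntegral.integral_const_mul, ← intervalIntegral.integral_const_mul,
      ← intervalIntegral.integral_sub, ← intervalIntegral.integral_add]
    · refine intervalIntegral.integral_congr fun y _ => ?_
      simp only [norm_sq_eq_re_im, ← hG y, hW]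
      simp [pow_two]
      ring
    all_goals exact Continuous.intervalIntegrable (by fun_prop) _ _
  rw [hz] at e
  have a1 := integral_le_L2I_mul_L2I (h := fun y => (G y).im * (W y).re - (G y).re * (W y).im)
    cG cW (by fun_prop) (fun y => im_mul_conj_le _ _)
  have a2 := integral_le_L2I_mul_L2I (h := fun y => -((G y).im * (W y).re - (G y).re * (W y).im))
    cG cW (by fun_prop) (fun y => by linarith [im_mul_conj_ge (G y) (W y)])
  have b1 := integral_le_L2I_mul_L2I
    (h := fun y => (deriv w y).im * (w y).re - (deriv w y).re * (w y).im)
    c1 c0 (by fun_prop) (fun y => im_mul_conj_le _ _)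
  have b2 := integral_le_L2I_mul_L2I
    (h := fun y => -((deriv w y).im * (w y).re - (deriv w y).re * (w y).im))
    c1 c0 (by fun_prop) (fun y => by linarith [im_mul_conj_ge (deriv w y) (w y)])
  rw [intervalIntegral.integral_neg] at a2 b2
  have b1' := mul_le_mul_of_nonneg_left b1 hν
  have b2' := mul_le_mul_of_nonneg_left b2 hν
  rcases abs_cases k with ⟨hk, -⟩ | ⟨hk, -⟩ <;> rw [hk] <;> linarith

lemma integral_lorentzian_le {m : ℝ} (hm : 0 < m) (lam : ℝ) :
    ∫ y in (-1:ℝ)..1, 1 / (m ^ 2 + (y - lam) ^ 2) ≤ Real.pi / m := by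
  have hd : ∀ y : ℝ, HasDerivAt (fun y => Real.arctan ((y - lam) / m) / m)
      (1 / (m ^ 2 + (y - lam) ^ 2)) y := by
    intro y
    have := ((((hasDerivAt_id y).sub_const lam).div_const m).arctan).div_const m
    refine this.congr_deriv ?_
    have : m ^ 2 + (y - lam) ^ 2 ≠ 0 := by positivity
    simp only [id]
    field_simp
  have hc : Continuous fun y : ℝ => 1 / (m ^ 2 + (y - lam) ^ 2) :=
    continuous_const.div (by fun_prop) fun y => by positivity
  rw [intervalIntegral.integral_eq_sub_of_hasDerivAt (fun y _ => hd y) (hc.intervalIntegrable _ _),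
    ← sub_div]
  gcongr
  linarith [Real.arctan_lt_pi_div_two ((1 - lam) / m),
    Real.neg_pi_div_two_lt_arctan ((-1 - lam) / m)]

/-- The `L¹` norm is controlled by the `L²` norms of `w` and `(y-λ)w`. -/
lemma L1I_le_of_weight {w : ℝ → ℂ} (hw : Continuous w) (lam : ℝ) {m t : ℝ} (hm : 0 < m)
    (ht : 0 < t) :
    L1I w ≤ 1 / 2 * (t * (Real.pi / m)
      + (m ^ 2 * L2I w ^ 2 + L2I (fun y => ((y : ℂ) - (lam : ℂ)) * w y) ^ 2) / t) := by
  have hc : Continuous fun y : ℝ => 1 / (m ^ 2 + (y - lam) ^ 2) :=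
    continuous_const.div (by fun_prop) fun y => by positivity
  have h1 : L1I w ≤ ∫ y in (-1:ℝ)..1, ((t / 2) * (1 / (m ^ 2 + (y - lam) ^ 2))
      + ((m ^ 2 / (2 * t)) * ‖w y‖ ^ 2
        + (1 / (2 * t)) * ‖((y : ℂ) - (lam : ℂ)) * w y‖ ^ 2)) := by
    refine intervalIntegral.integral_mono_on (by norm_num)
      (Continuous.intervalIntegrable (by fun_prop) _ _)
      (Continuous.intervalIntegrable (by fun_prop) _ _) fun y _ => ?_
    have hn : ‖((y : ℂ) - (lam : ℂ)) * w y‖ ^ 2 = (y - lam) ^ 2 * ‖w y‖ ^ 2 := by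
      rw [norm_mul, mul_pow, ← Complex.ofReal_sub, Complex.norm_real, Real.norm_eq_abs, sq_abs]
    rw [hn]
    set x := ‖w y‖
    set q := m ^ 2 + (y - lam) ^ 2 with hq
    have hq0 : 0 < q := by positivity
    have : t / 2 * (1 / q) + (m ^ 2 / (2 * t) * x ^ 2 + 1 / (2 * t) * ((y - lam) ^ 2 * x ^ 2)) - x
        = (t - q * x) ^ 2 / (2 * t * q) := by
      have : (m ^ 2 / (2 * t) * x ^ 2 + 1 / (2 * t) * ((y - lam) ^ 2 * x ^ 2))
          = q * x ^ 2 / (2 * t) := by rw [hq]; field_simp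
      rw [this]
      field_simp
      ring
    have h2 : 0 ≤ (t - q * x) ^ 2 / (2 * t * q) := by positivity
    linarith
  rw [intervalIntegral.integral_add, intervalIntegral.integral_add,
    intervalIntegral.integral_const_mul, intervalIntegral.integral_const_mul,
    intervalIntegral.integral_const_mul, ← L2I_sq,
    ← L2I_sq (fun y => ((y : ℂ) - (lam : ℂ)) * w y)] at h1
  · have h3 := mul_le_mul_of_nonneg_left (integral_lorentzian_le hm lam) (half_pos ht).le
    refine h1.trans ?_
    refine (add_le_add_left h3 _).trans (le_of_eq ?_)
    field_simp
  all_goals exact Continuous.intervalIntegrable (by fun_prop) _ _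

/-- A function vanishing at `-1` is bounded by the `L²` norm of its derivative. -/
lemma norm_le_two_mul_L2I_deriv {φ : ℝ → ℂ} (hφ : ContDiff ℝ 2 φ) (h0 : φ (-1) = 0) {y : ℝ}
    (hy : y ∈ Icc (-1:ℝ) 1) : ‖φ y‖ ≤ 2 * L2I (deriv φ) := by
  obtain ⟨d1, -, c0, c1, -⟩ := contDiff_two_data hφ
  have e : φ y = ∫ x in (-1:ℝ)..y, deriv φ x := by
    rw [intervalIntegral.integral_eq_sub_of_hasDerivAt (fun x _ => d1 x)
      (c1.intervalIntegrable _ _), h0, sub_zero]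
  have hcs := integral_norm_mul_norm_le c1 (continuous_const (y := (1:ℂ)))
  have hone : L2I (fun _ => (1:ℂ)) ≤ 2 := by
    have := L2I_sq (fun _ => (1:ℂ))
    norm_num at this
    nlinarith
  calc ‖φ y‖ ≤ ∫ x in (-1:ℝ)..y, ‖deriv φ x‖ := by
        rw [e]; exact intervalIntegral.norm_integral_le_integral_norm hy.1
    _ ≤ ∫ x in (-1:ℝ)..1, ‖deriv φ x‖ :=
        intervalIntegral.integral_mono_interval le_rfl hy.1 hy.2
          (Filter.Eventually.of_forall fun _ => norm_nonneg _)
          (Continuous.intervalIntegrable (by fun_prop) _ _)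
    _ ≤ L2I (deriv φ) * L2I (fun _ => (1:ℂ)) := by simpa using hcs
    _ ≤ 2 * L2I (deriv φ) := by nlinarith [L2I_nonneg (deriv φ)]

/-- The velocity is controlled by the `L¹` norm of the vorticity. -/
lemma uNorm_le_two_mul_L1I {k : ℝ} {w φ : ℝ → ℂ} (hw : Continuous w) (h : IsStream k w φ) :
    uNorm k φ ≤ 2 * L1I w := by
  obtain ⟨hφ, h0, h1, hE⟩ := h
  obtain ⟨d1, d2, c0, c1, c2⟩ := contDiff_two_data hφ
  have hU : uNorm k φ ^ 2 = L2I (deriv φ) ^ 2 + k ^ 2 * L2I φ ^ 2 := Real.sq_sqrt (by positivity)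
  have hU0 : 0 ≤ uNorm k φ := Real.sqrt_nonneg _
  have hL : 0 ≤ L1I w := intervalIntegral.integral_nonneg (by norm_num) fun _ _ => norm_nonneg _
  have hdU : L2I (deriv φ) ≤ uNorm k φ := by
    refine Real.le_sqrt_of_sq_le ?_
    have : 0 ≤ k ^ 2 * L2I φ ^ 2 := by positivity
    linarith
  have hz := integral_eq_zero_of_hasDerivAt
    (g := fun y => (deriv φ y).re * (φ y).re + (deriv φ y).im * (φ y).im)
    (g' := fun y => (deriv (deriv φ) y).re * (φ y).re + (deriv φ y).re * (deriv φ y).re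
      + ((deriv (deriv φ) y).im * (φ y).im + (deriv φ y).im * (deriv φ y).im))
    (fun y => ((hasDerivAt_re (d2 y)).mul (hasDerivAt_re (d1 y))).add
      ((hasDerivAt_im (d2 y)).mul (hasDerivAt_im (d1 y))))
    (by fun_prop) (by simp [h0]) (by simp [h1])
  have e : ∫ y in (-1:ℝ)..1, -((w y).re * (φ y).re + (w y).im * (φ y).im)
      = L2I (deriv φ) ^ 2 + k ^ 2 * L2I φ ^ 2
        - ∫ y in (-1:ℝ)..1, ((deriv (deriv φ) y).re * (φ y).re
          + (deriv φ y).re * (deriv φ y).re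
          + ((deriv (deriv φ) y).im * (φ y).im + (deriv φ y).im * (deriv φ y).im)) := by
    rw [L2I_sq, L2I_sq, ← intervalIntegral.integral_const_mul,
      ← intervalIntegral.integral_add, ← intervalIntegral.integral_sub]
    · refine intervalIntegral.integral_congr fun y hy => ?_
      rw [uIcc_of_le (by norm_num)] at hy
      simp only [norm_sq_eq_re_im, ← hE y hy]
      simp [pow_two]
      ring
    all_goals exact Continuous.intervalIntegrable (by fun_prop) _ _
  have hle : ∫ y in (-1:ℝ)..1, -((w y).re * (φ y).re + (w y).im * (φ y).im)
      ≤ ∫ y in (-1:ℝ)..1, ‖w y‖ * (2 * uNorm k φ) := by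
    refine intervalIntegral.integral_mono_on (by norm_num)
      (Continuous.intervalIntegrable (by fun_prop) _ _)
      (Continuous.intervalIntegrable (by fun_prop) _ _) fun y hy => ?_
    have h2 := re_mul_conj_le (-(w y)) (φ y)
    rw [norm_neg] at h2
    have h3 := norm_le_two_mul_L2I_deriv hφ h0 hy
    have h4 : ‖w y‖ * ‖φ y‖ ≤ ‖w y‖ * (2 * uNorm k φ) := by gcongr; linarith
    simp at h2
    linarith
  rw [intervalIntegral.integral_mul_const, e, hz, sub_zero, ← hU] at hle
  change uNorm k φ ^ 2 ≤ L1I w * (2 * uNorm k φ) at hle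
  by_contra! hlt
  nlinarith

/-- Closing the system of inequalities for the scaled norms. -/
lemma scaled_norm_bounds {a b d n ε : ℝ} (ha : 0 ≤ a) (hb : 0 ≤ b) (hd : 0 ≤ d) (hn : 0 ≤ n)
    (hε : ε ≤ 1 / 32) (h1 : a ^ 2 ≤ ε * b ^ 2 + n * b) (h2 : d ^ 2 ≤ n * d + a * b)
    (h3 : b ^ 2 ≤ 2 * (d * a)) : a ≤ 8 * n ∧ b ≤ 32 * n ∧ d ≤ 17 * n := by
  have h1' : a ^ 2 ≤ 1 / 32 * b ^ 2 + n * b := by nlinarith [sq_nonneg b]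
  have hb32 : b ≤ 32 * n := by
    by_contra! hlt
    have hb0 : 0 < b := by linarith
    have ha4 : a ≤ b / 4 := abs_le_of_sq_le_sq' (by nlinarith) (by positivity) |>.2
    have hd' : d ≤ 3 / 5 * b := by
      by_contra! hd'
      have : n * d ≤ b / 32 * d := by gcongr; linarith
      nlinarith
    nlinarith [mul_le_mul hd' ha4 ha (by positivity)]
  have ha8 : a ≤ 8 * n := abs_le_of_sq_le_sq' (by nlinarith) (by positivity) |>.2
  refine ⟨ha8, hb32, ?_⟩
  by_contra! hlt
  nlinarith [mul_le_mul ha8 hb32 hb (by positivity)]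

/-- resolvent estimate with Navier-slip boundary condition, `F ∈ L²`. -/
theorem stmt_1 :
    ∃ C > 0, ∃ ε₀ ∈ Ioo (0:ℝ) 1, ∀ ν ∈ Ioc (0:ℝ) 1, ∀ k : ℝ,
      10 * ν ≤ |k| → |k| < 1 → ∀ lam : ℝ, ∀ ε ∈ Icc (0:ℝ) ε₀,
      ∀ F : ℝ → ℂ, ContinuousOn F (Icc (-1:ℝ) 1) →
      ∀ w φ : ℝ → ℂ, NavierSlipOS ν k lam ε w F → IsStream k w φ →
      ν ^ ((1:ℝ)/6) * |k| ^ ((5:ℝ)/6) * uNorm k φ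
        + ν ^ ((1:ℝ)/6) * |k| ^ ((5:ℝ)/6) * L1I w
        + ν ^ ((2:ℝ)/3) * |k| ^ ((1:ℝ)/3) * L2I (deriv w)
        + (ν * k ^ 2) ^ ((1:ℝ)/3) * L2I w
        + |k| * L2I (fun y => ((y : ℂ) - (lam : ℂ)) * w y)
      ≤ C * L2I F := by
  refine ⟨2100, by norm_num, 1 / 32, by norm_num, ?_⟩
  intro ν hν k hk _ lam ε hε F _ w φ ⟨hw, h0, h1, hE⟩ hφ
  have hν0 : 0 < ν := hν.1
  have hκ : 0 < |k| := by linarith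
  set κ := |k| with hκdef
  obtain ⟨r, hr, hνr⟩ : ∃ r : ℝ, 0 < r ∧ ν = κ * r ^ 6 := by
    refine ⟨(ν / κ) ^ ((1:ℝ) / 6), by positivity, ?_⟩
    rw [← Real.rpow_natCast, ← Real.rpow_mul (by positivity)]
    norm_num
    field_simp
  have hpow : ∀ s t : ℝ, s + t = 1 → ν ^ s * κ ^ t = κ * r ^ (6 * s) := by
    intro s t hst
    rw [hνr, Real.mul_rpow hκ.le (by positivity), ← Real.rpow_natCast, ← Real.rpow_mul hr.le,
      mul_right_comm, ← Real.rpow_add hκ, hst, Real.rpow_one]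
    norm_num
  have p1 : ν ^ ((1:ℝ)/6) * κ ^ ((5:ℝ)/6) = κ * r := by
    rw [hpow _ _ (by norm_num)]; norm_num
  have p2 : ν ^ ((2:ℝ)/3) * κ ^ ((1:ℝ)/3) = κ * r ^ 4 := by
    rw [hpow _ _ (by norm_num), ← Real.rpow_natCast]; norm_num
  have p3 : ν ^ ((1:ℝ)/3) * κ ^ ((2:ℝ)/3) = κ * r ^ 2 := by
    rw [hpow _ _ (by norm_num), ← Real.rpow_natCast]; norm_num
  have p4 : (ν * k ^ 2) ^ ((1:ℝ)/3) = κ * r ^ 2 := by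
    rw [← p3, ← sq_abs k, ← hκdef, Real.mul_rpow hν0.le (by positivity), ← Real.rpow_natCast,
      ← Real.rpow_mul hκ.le]
    norm_num
  rw [p1, p2, p4]
  rw [mul_assoc ε, p3] at hE
  set G : ℝ → ℂ := fun y => -(ν : ℂ) * (deriv (deriv w) y - (k : ℂ) ^ 2 * w y)
      + Complex.I * (k : ℂ) * ((y : ℂ) - (lam : ℂ)) * w y
      - ((ε * (κ * r ^ 2) : ℝ) : ℂ) * w y with hG
  have hFG : L2I F = L2I G := L2I_congr fun y hy => (hE y hy).symm
  have e1 := energy_estimate (G := G) hν0.le hw h0 h1 fun y => rfl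
  have e2 := weighted_estimate (G := G) hν0.le hw h0 h1 fun y => rfl
  have e3 := L2I_sq_le_weight_mul_deriv hw h0 h1 lam
  have e4 := uNorm_le_two_mul_L1I hw.continuous hφ
  have e5 := fun (t : ℝ) (ht : 0 < t) =>
    L1I_le_of_weight hw.continuous lam (m := r ^ 2) (by positivity) ht
  rw [← hFG] at e1 e2
  rw [← hκdef] at e2
  have hA := L2I_nonneg (deriv w)
  have hB := L2I_nonneg w
  have hD := L2I_nonneg (fun y => ((y : ℂ) - (lam : ℂ)) * w y)
  have hN := L2I_nonneg F
  set A := L2I (deriv w)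
  set B := L2I w
  set D := L2I (fun y => ((y : ℂ) - (lam : ℂ)) * w y)
  set U := uNorm k φ
  set L := L1I w
  obtain ⟨n, hn⟩ : ∃ n, L2I F = κ * n := ⟨L2I F / κ, by field_simp⟩
  rw [hn] at e1 e2 hN ⊢
  have hn0 : 0 ≤ n := nonneg_of_mul_nonneg_right hN hκ
  rw [hνr] at e1 e2
  have e1' : r ^ 6 * A ^ 2 ≤ ε * r ^ 2 * B ^ 2 + n * B :=
    le_of_mul_le_mul_left (by linarith) hκ
  have e2' : D ^ 2 ≤ n * D + r ^ 6 * (A * B) :=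
    le_of_mul_le_mul_left (by linarith) hκ
  obtain ⟨ha, hb, hd⟩ := scaled_norm_bounds (a := r ^ 4 * A) (b := r ^ 2 * B) (d := D) (n := n)
    (by positivity) (by positivity) hD hn0 hε.2
    (by have := mul_le_mul_of_nonneg_left e1' (sq_nonneg r); linarith)
    (by linarith)
    (by have := mul_le_mul_of_nonneg_left e3 (pow_nonneg hr.le 4); linarith)
  have hL : r * L ≤ 660 * n := by
    refine le_of_forall_pos_le_add fun η hη => ?_
    set M := n + η / 660 with hM
    have hM0 : 0 < M := by positivity
    have hnM : n ≤ M := by rw [hM]; linarith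
    have h5 := mul_le_mul_of_nonneg_left (e5 (r * M) (by positivity)) hr.le
    have hb2 : (r ^ 2 * B) ^ 2 ≤ (32 * M) ^ 2 :=
      pow_le_pow_left₀ (by positivity) (by linarith) 2
    have hd2 : D ^ 2 ≤ (17 * M) ^ 2 := pow_le_pow_left₀ hD (by linarith) 2
    have h6 : r * (1 / 2 * (r * M * (Real.pi / r ^ 2) + ((r ^ 2) ^ 2 * B ^ 2 + D ^ 2) / (r * M)))
        = 1 / 2 * (Real.pi * M + ((r ^ 2 * B) ^ 2 + D ^ 2) / M) := by field_simp
    have h7 : ((r ^ 2 * B) ^ 2 + D ^ 2) / M ≤ 1313 * M := by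
      rw [div_le_iff₀ hM0]; linarith
    have h8 : Real.pi * M ≤ 4 * M := by gcongr; exact Real.pi_le_four
    have : 660 * n + η = 660 * M := by rw [hM]; ring
    linarith
  have hU : r * U ≤ 1320 * n := by
    have := mul_le_mul_of_nonneg_left e4 hr.le
    linarith
  have : κ * (r * U + r * L + r ^ 4 * A + r ^ 2 * B + D) ≤ κ * (2100 * n) := by
    gcongr; linarith
  linarith
end
end

section
/- For every ψ∈C²(I,ℂ) with ψ(1)=ψ(−1)=0 and ψ′(1)=ψ′(−1)=0, one has |∫_{−1}^{1} ψ′(y)·\overline{ψ(y)} dy| ≤ (3/π³)‖ψ″‖²_{L²(I)}. -/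
open MeasureTheory Set

/-- A continuous function is square integrable on a bounded half-open interval. -/
lemma Continuous.memLp_two_restrict_Ioc {f : ℝ → ℂ} (hf : Continuous f) (a b : ℝ) :
    MemLp f 2 (volume.restrict (Ioc a b)) := by
  obtain ⟨C, hC⟩ := isCompact_Icc.exists_bound_of_continuousOn (s := Icc a b) hf.continuousOn
  refine MemLp.of_bound hf.aestronglyMeasurable C ?_
  filter_upwards [ae_restrict_mem measurableSet_Ioc] with x hx
  exact hC x (Ioc_subset_Icc_self hx)

/-- **Wirtinger's inequality** for mean-zero functions with equal boundary values. -/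
lemma integral_norm_sq_le_integral_norm_deriv_sq {a b : ℝ} (hab : a < b) {f f' : ℝ → ℂ}
    (hf : ∀ x, HasDerivAt f (f' x) x) (hf' : Continuous f') (hbd : f a = f b)
    (hmean : ∫ x in a..b, f x = 0) :
    ∫ x in a..b, ‖f x‖ ^ 2 ≤ ((b - a) / (2 * Real.pi)) ^ 2 * ∫ x in a..b, ‖f' x‖ ^ 2 := by
  have hfc : Continuous f := continuous_iff_continuousAt.2 fun x => (hf x).continuousAt
  have hba : 0 < b - a := sub_pos.2 hab
  have hpi := Real.pi_pos
  have hcoeff (n : ℤ) : ‖fourierCoeffOn hab f n‖ ^ 2 ≤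
      ((b - a) / (2 * Real.pi)) ^ 2 * ‖fourierCoeffOn hab f' n‖ ^ 2 := by
    rcases eq_or_ne n 0 with rfl | hn
    · have h0 : fourierCoeffOn hab f 0 = 0 := by
        rw [fourierCoeffOn_eq_integral]
        simp [hmean]
      rw [h0, norm_zero, zero_pow two_ne_zero]
      positivity
    · rw [fourierCoeffOn_of_hasDerivAt hab hn (fun x _ => hf x) (hf'.intervalIntegrable a b),
        hbd, sub_self, mul_zero, zero_sub, ← mul_pow]
      have hn1 : (1 : ℝ) ≤ |(n : ℝ)| := by exact_mod_cast Int.one_le_abs hn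
      have hnorm : ‖(1 : ℂ) / (-2 * Real.pi * Complex.I * n) *
          -(((b : ℂ) - a) * fourierCoeffOn hab f' n)‖ =
          (b - a) / (2 * Real.pi) * ‖fourierCoeffOn hab f' n‖ / |(n : ℝ)| := by
        rw [← Complex.ofReal_sub]
        simp only [norm_mul, norm_div, norm_neg, norm_one, Complex.norm_I, Complex.norm_real,
          Complex.norm_intCast, Real.norm_eq_abs, abs_of_pos hpi, abs_of_pos hba,
          Complex.norm_ofNat]
        field_simp
      rw [hnorm]
      gcongr
      exact div_le_self (by positivity) hn1
  have h := hasSum_le hcoeff (hasSum_sq_fourierCoeffOn hab (hfc.memLp_two_restrict_Ioc a b))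
    ((hasSum_sq_fourierCoeffOn hab (hf'.memLp_two_restrict_Ioc a b)).mul_left _)
  rw [smul_eq_mul, smul_eq_mul, mul_left_comm] at h
  exact le_of_mul_le_mul_left h (inv_pos.2 hba)

/-- For every `ψ ∈ C²(I,ℂ)` with `ψ(±1)=0` and `ψ′(±1)=0`, one has
`|∫_{−1}^{1} ψ′(y)·conj(ψ(y)) dy| ≤ (3/π³)‖ψ″‖²_{L²(I)}`. -/
theorem stmt_19 (ψ : ℝ → ℂ) (hψ : ContDiff ℝ 2 ψ)
    (hb1 : ψ 1 = 0) (hb2 : ψ (-1) = 0)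
    (hb1' : deriv ψ 1 = 0) (hb2' : deriv ψ (-1) = 0) :
    ‖∫ y in (-1:ℝ)..1, deriv ψ y * (starRingEnd ℂ) (ψ y)‖ ≤
      (3 / Real.pi ^ 3) * (∫ y in (-1:ℝ)..1, ‖deriv (deriv ψ) y‖ ^ 2) := by
  have hpi := Real.pi_pos
  have hlt : (-1 : ℝ) < 1 := by norm_num
  have hψ' : ContDiff ℝ 1 (deriv ψ) := ContDiff.deriv' (n := 1) hψ
  have hc : Continuous ψ := hψ.continuous
  have hc' : Continuous (deriv ψ) := hψ'.continuous
  have hc'' : Continuous (deriv (deriv ψ)) := hψ'.continuous_deriv le_rfl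
  have hd (x : ℝ) : HasDerivAt ψ (deriv ψ x) x :=
    (hψ.differentiable two_ne_zero x).hasDerivAt
  have hd' (x : ℝ) : HasDerivAt (deriv ψ) (deriv (deriv ψ) x) x :=
    (hψ'.differentiable one_ne_zero x).hasDerivAt
  have hmean' : ∫ y in (-1 : ℝ)..1, deriv ψ y = 0 := by
    rw [intervalIntegral.integral_eq_sub_of_hasDerivAt (fun x _ => hd x)
      (hc'.intervalIntegrable _ _), hb1, hb2, sub_self]
  set c : ℂ := (∫ y in (-1 : ℝ)..1, ψ y) / 2 with hcdef
  have hmean : ∫ y in (-1 : ℝ)..1, (ψ y - c) = 0 := by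
    rw [intervalIntegral.integral_sub (hc.intervalIntegrable _ _) (by simp),
      intervalIntegral.integral_const, hcdef, Complex.real_smul]
    push_cast
    ring
  have hconst : (1 - -1 : ℝ) / (2 * Real.pi) = 1 / Real.pi := by
    field_simp
    norm_num
  have hW := integral_norm_sq_le_integral_norm_deriv_sq hlt
    (fun x => (hd x).sub_const c) hc' (by rw [hb1, hb2]) hmean
  have hW' := integral_norm_sq_le_integral_norm_deriv_sq hlt hd' hc'' (by rw [hb1', hb2']) hmean'
  rw [hconst] at hW hW'
  have hshift : ∫ y in (-1 : ℝ)..1, deriv ψ y * (starRingEnd ℂ) (ψ y) =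
      ∫ y in (-1 : ℝ)..1, deriv ψ y * (starRingEnd ℂ) (ψ y - c) := by
    have hi : Continuous fun y => deriv ψ y * (starRingEnd ℂ) (ψ y) :=
      hc'.mul (Complex.continuous_conj.comp hc)
    have hj : Continuous fun y => deriv ψ y * (starRingEnd ℂ) c := hc'.mul continuous_const
    simp_rw [map_sub, mul_sub]
    rw [intervalIntegral.integral_sub (hi.intervalIntegrable _ _)
      (hj.intervalIntegrable _ _),
      intervalIntegral.integral_mul_const, hmean', zero_mul, sub_zero]
  have hcφ : Continuous fun y => ‖ψ y - c‖ ^ 2 := by fun_prop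
  have hcn : Continuous fun y => ‖deriv ψ y‖ ^ 2 := by fun_prop
  have hJ : 0 ≤ ∫ y in (-1 : ℝ)..1, ‖deriv (deriv ψ) y‖ ^ 2 :=
    intervalIntegral.integral_nonneg hlt.le fun _ _ => by positivity
  calc ‖∫ y in (-1 : ℝ)..1, deriv ψ y * (starRingEnd ℂ) (ψ y)‖
      ≤ ∫ y in (-1 : ℝ)..1,
          (Real.pi / 2 * ‖ψ y - c‖ ^ 2 + 1 / (2 * Real.pi) * ‖deriv ψ y‖ ^ 2) := by
        rw [hshift]
        refine intervalIntegral.norm_integral_le_of_norm_le hlt.le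
          (Filter.Eventually.of_forall fun y _ => ?_)
          (((hcφ.const_mul _).add (hcn.const_mul _)).intervalIntegrable _ _)
        rw [norm_mul, RCLike.norm_conj, ← sub_nonneg]
        have h : Real.pi / 2 * ‖ψ y - c‖ ^ 2 + 1 / (2 * Real.pi) * ‖deriv ψ y‖ ^ 2 -
            ‖deriv ψ y‖ * ‖ψ y - c‖ =
            (Real.pi * ‖ψ y - c‖ - ‖deriv ψ y‖) ^ 2 / (2 * Real.pi) := by
          field_simp
          ring
        rw [h]
        positivity
    _ = Real.pi / 2 * (∫ y in (-1 : ℝ)..1, ‖ψ y - c‖ ^ 2) +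
          1 / (2 * Real.pi) * ∫ y in (-1 : ℝ)..1, ‖deriv ψ y‖ ^ 2 := by
        rw [intervalIntegral.integral_add ((hcφ.const_mul _).intervalIntegrable _ _)
          ((hcn.const_mul _).intervalIntegrable _ _), intervalIntegral.integral_const_mul,
          intervalIntegral.integral_const_mul]
    _ ≤ Real.pi / 2 * ((1 / Real.pi) ^ 2 * ∫ y in (-1 : ℝ)..1, ‖deriv ψ y‖ ^ 2) +
          1 / (2 * Real.pi) * ∫ y in (-1 : ℝ)..1, ‖deriv ψ y‖ ^ 2 := by gcongr
    _ = 1 / Real.pi * ∫ y in (-1 : ℝ)..1, ‖deriv ψ y‖ ^ 2 := by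
        field_simp
        ring
    _ ≤ 1 / Real.pi * ((1 / Real.pi) ^ 2 * ∫ y in (-1 : ℝ)..1, ‖deriv (deriv ψ) y‖ ^ 2) := by
        gcongr
    _ = 1 / Real.pi ^ 3 * ∫ y in (-1 : ℝ)..1, ‖deriv (deriv ψ) y‖ ^ 2 := by
        field_simp
    _ ≤ 3 / Real.pi ^ 3 * ∫ y in (-1 : ℝ)..1, ‖deriv (deriv ψ) y‖ ^ 2 := by
        gcongr
        norm_num
end
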